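/- For every n ≥ 1, the bi-statistics (maj, comaj) and (inv, coinv) have the same joint distribution over R_n; more precisely, there exists a bijection ξ: R_n → R_n such that ξ(F) is isomorphic to F as a rooted forest, maj(F) = inv(ξ(F)), and comaj(F) = coinv(ξ(F)) for all F ∈ R_n. -/

import Mathlib

/-- A rooted forest on vertex set `V`, encoded by its parent function:
`parent v = some u` means `u` is the parent of `v` (edges are directed away from
the roots, so `(u,v)` is an edge), and `parent v = none` means `v` is a root.
Acyclicity guarantees that every connected component is a tree with a
distinguished root. -/
structure RootedForest (V : Type) where
  parent : V → Option V
  acyclic : ∀ v : V, ¬ Relation.TransGen (fun a b : V => parent a = some b) v v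

namespace RootedForest

variable {V : Type} [Fintype V] [LinearOrder V]

/-- `F.Desc u v` means `v` is a (strict) descendant of `u`. -/
def Desc (F : RootedForest V) (u v : V) : Prop :=
  Relation.TransGen (fun a b : V => F.parent a = some b) v u

/-- The hook of `u`: `u` together with all of its descendants. -/
def hook (F : RootedForest V) (u : V) : Set V := {v : V | v = u ∨ F.Desc u v}

/-- The hook length `h(u)`. -/
noncomputable def h (F : RootedForest V) (u : V) : ℕ := (F.hook u).ncard

/-- The left hook length `h_L(u)`: sum of hook lengths of children smaller than `u`. -/
noncomputable def hL (F : RootedForest V) (u : V) : ℕ :=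
  ∑ v ∈ Finset.univ.filter (fun v : V => F.parent v = some u ∧ v < u), F.h v

/-- The right hook length `h_R(u)`: sum of hook lengths of children larger than `u`. -/
noncomputable def hR (F : RootedForest V) (u : V) : ℕ :=
  ∑ v ∈ Finset.univ.filter (fun v : V => F.parent v = some u ∧ u < v), F.h v

/-- The major index of a rooted forest. -/
noncomputable def maj (F : RootedForest V) : ℕ := ∑ u : V, F.hL u

/-- The comajor index of a rooted forest. -/
noncomputable def comaj (F : RootedForest V) : ℕ := ∑ u : V, F.hR u

/-- The number of inversions: pairs `(u,v)` with `v` a descendant of `u` and `v < u`. -/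
noncomputable def inv (F : RootedForest V) : ℕ :=
  {p : V × V | F.Desc p.1 p.2 ∧ p.2 < p.1}.ncard

/-- The number of coinversions: pairs `(u,v)` with `v` a descendant of `u` and `v > u`. -/
noncomputable def coinv (F : RootedForest V) : ℕ :=
  {p : V × V | F.Desc p.1 p.2 ∧ p.1 < p.2}.ncard

/-- The number of connected components (= number of roots). -/
def comps (F : RootedForest V) : ℕ :=
  (Finset.univ.filter (fun v : V => F.parent v = none)).card

end RootedForest

/-- A `k`-forest on vertex set `Fin n` (vertices `1,…,n`): a rooted forest together with a
colour in `{0,…,k-1}` on each edge.  The colour of the edge `(parent v, v)` is recorded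
at the vertex `v`; roots carry the dummy colour `0`. -/
structure KForest (n k : ℕ) extends RootedForest (Fin n) where
  colour : Fin n → ℕ
  colour_lt : ∀ v, colour v < k
  colour_root : ∀ v, parent v = none → colour v = 0

namespace KForest

variable {n k : ℕ}

/-- The chromatic depth `chr_k(F) = ∑_{(u,v) ∈ E(F)} κ(u,v)·h(v)`. -/
noncomputable def chr (F : KForest n k) : ℕ :=
  ∑ v ∈ Finset.univ.filter (fun v : Fin n => F.parent v ≠ none),
    F.colour v * F.toRootedForest.h v

/-- The chromatic codepth `cochr_k(F) = ∑_{(u,v) ∈ E(F)} (k-1-κ(u,v))·h(v)`. -/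
noncomputable def cochr (F : KForest n k) : ℕ :=
  ∑ v ∈ Finset.univ.filter (fun v : Fin n => F.parent v ≠ none),
    (k - 1 - F.colour v) * F.toRootedForest.h v

/-- `maj_k = maj + chr_k`. -/
noncomputable def majk (F : KForest n k) : ℕ := F.toRootedForest.maj + F.chr

/-- `comaj_k = comaj + cochr_k`. -/
noncomputable def comajk (F : KForest n k) : ℕ := F.toRootedForest.comaj + F.cochr

/-- `inv_k = inv + chr_k`. -/
noncomputable def invk (F : KForest n k) : ℕ := F.toRootedForest.inv + F.chr

/-- `coinv_k = coinv + cochr_k`. -/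
noncomputable def coinvk (F : KForest n k) : ℕ := F.toRootedForest.coinv + F.cochr

end KForest

/-- A minimal factorization of the long cycle `(0 1 ⋯ n)` on `{0,1,…,n}` into `n`
transpositions `(aᵢ bᵢ)` with `aᵢ < bᵢ`, multiplied left to right (the leftmost factor
is applied first, which corresponds to the reversed product in Mathlib's convention). -/
structure MinFact (n : ℕ) where
  a : Fin n → Fin (n+1)
  b : Fin n → Fin (n+1)
  ab_lt : ∀ i, a i < b i
  prod_eq : (List.ofFn (fun i => Equiv.swap (a i) (b i))).reverse.prod = finRotate (n+1)

namespace MinFact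

variable {n : ℕ}

/-- `area(f) = C(n,2) - ∑ aᵢ`. -/
def area (f : MinFact n) : ℤ := (n.choose 2 : ℤ) - ∑ i : Fin n, ((f.a i : ℕ) : ℤ)

/-- `coarea(f) = ∑ (bᵢ - 1) - C(n,2)`. -/
def coarea (f : MinFact n) : ℤ :=
  (∑ i : Fin n, (((f.b i : ℕ) : ℤ) - 1)) - (n.choose 2 : ℤ)

end MinFact

/-- A minimal `k`-factorization of the long cycle `(0 1 ⋯ kn)` on `{0,1,…,kn}` into `n`
cycles of length `k+1`: the `j`-th factor is the cycle `(a j 0, a j 1, …, a j k)`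
(sending `a j 0 ↦ a j 1 ↦ ⋯ ↦ a j k ↦ a j 0`), presented with its least element first,
and the factors are multiplied left to right (leftmost applied first). -/
structure MinKFact (n k : ℕ) where
  a : Fin n → Fin (k+1) → Fin (k*n+1)
  inj : ∀ j, Function.Injective (a j)
  min_first : ∀ j i, a j 0 ≤ a j i
  prod_eq :
    (List.ofFn (fun j => (List.ofFn (a j)).formPerm)).reverse.prod = finRotate (k*n+1)

namespace MinKFact

variable {n k : ℕ}

/-- `area_k(f) = C(kn,2) - n·C(k,2) - k·∑_j a_j^0`. -/
def areak (f : MinKFact n k) : ℤ :=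
  ((k*n).choose 2 : ℤ) - n * (k.choose 2 : ℤ) - k * ∑ j : Fin n, ((f.a j 0 : ℕ) : ℤ)

/-- `coarea_k(f) = k·∑_j (a_j^k - 1) - C(kn,2) - n·C(k,2)`. -/
def coareak (f : MinKFact n k) : ℤ :=
  k * (∑ j : Fin n, (((f.a j (Fin.last k) : ℕ) : ℤ) - 1))
    - ((k*n).choose 2 : ℤ) - n * (k.choose 2 : ℤ)

/-- `semiarea_k(f) = C(kn,2) - ∑_{i=0}^{k-1} ∑_j a_j^i`. -/
def semiareak (f : MinKFact n k) : ℤ :=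
  ((k*n).choose 2 : ℤ) - ∑ i : Fin k, ∑ j : Fin n, ((f.a j i.castSucc : ℕ) : ℤ)

/-- `cosemiarea_k(f) = ∑_{i=1}^{k} ∑_j (a_j^i - 1) - C(kn,2)`. -/
def cosemiareak (f : MinKFact n k) : ℤ :=
  (∑ i : Fin k, ∑ j : Fin n, (((f.a j i.succ : ℕ) : ℤ) - 1)) - ((k*n).choose 2 : ℤ)

end MinKFact

/-- `p` is a `k`-parking function: its nondecreasing rearrangement `b = p ∘ sort p`
satisfies `b i ≤ k * i` (with 0-indexed `i`, matching `bᵢ ≤ k(i-1)` for 1-indexed `i`). -/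
def IsParkingFunction (k : ℕ) {n : ℕ} (p : Fin n → ℕ) : Prop :=
  ∀ i : Fin n, p (Tuple.sort p i) ≤ k * i

/-- The displacement `disp_k(p) = k·C(n,2) - ∑ᵢ aᵢ` of a `k`-parking function. -/
def dispk (k : ℕ) {n : ℕ} (p : Fin n → ℕ) : ℤ :=
  k * (n.choose 2 : ℤ) - ∑ i : Fin n, (p i : ℤ)

namespace RootedForest

open Classical

variable {n : ℕ}

theorem ext' {F G : RootedForest (Fin n)} (h : ∀ v, F.parent v = G.parent v) : F = G := by
  cases F; cases G
  congr
  exact funext h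

/-- Relabelling. -/
def relabel (σ : Equiv.Perm (Fin n)) (F : RootedForest (Fin n)) : RootedForest (Fin n) where
  parent x := (F.parent (σ.symm x)).map σ
  acyclic v h := by
    refine F.acyclic (σ.symm v) (Relation.TransGen.lift σ.symm ?_ _ _ h)
    intro a b hab
    simp only [Option.map_eq_some_iff] at hab
    change F.parent _ = some _
    obtain ⟨c, hc, rfl⟩ := hab
    simpa using hc

theorem relabel_parent (σ : Equiv.Perm (Fin n)) (F : RootedForest (Fin n)) (v : Fin n) :
    (F.relabel σ).parent (σ v) = (F.parent v).map σ := by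
  simp [relabel]

theorem relabel_mul (σ τ : Equiv.Perm (Fin n)) (F : RootedForest (Fin n)) :
    F.relabel (σ * τ) = (F.relabel τ).relabel σ := by
  apply ext'
  intro v
  simp only [relabel, Option.map_map]
  rfl

theorem relabel_one (F : RootedForest (Fin n)) : F.relabel 1 = F := by
  apply ext'
  intro v
  have := relabel_parent 1 F v
  simpa using this

theorem relabel_desc (σ : Equiv.Perm (Fin n)) (F : RootedForest (Fin n)) (u v : Fin n) :
    (F.relabel σ).Desc (σ u) (σ v) ↔ F.Desc u v := by
  constructor
  · intro h
    have h2 := Relation.TransGen.lift (p := fun a b : Fin n => F.parent a = some b) σ.symm ?_ _ _ h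
    · simpa [Function.onFun, Desc] using h2
    intro a b hab
    simp only [relabel, Option.map_eq_some_iff] at hab
    change F.parent _ = some _
    obtain ⟨c, hc, rfl⟩ := hab
    simpa using hc
  · intro h
    refine Relation.TransGen.lift σ ?_ _ _ h
    intro a b hab
    change (F.relabel σ).parent (σ a) = some (σ b)
    rw [relabel_parent, hab]
    rfl

theorem relabel_h (σ : Equiv.Perm (Fin n)) (F : RootedForest (Fin n)) (u : Fin n) :
    (F.relabel σ).h (σ u) = F.h u := by
  unfold h
  have : (F.relabel σ).hook (σ u) = σ '' F.hook u := by
    ext x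
    obtain ⟨x, rfl⟩ := σ.surjective x
    simp [hook, relabel_desc]
  rw [this, Set.ncard_image_of_injective _ σ.injective]

theorem desc_irrefl (F : RootedForest (Fin n)) (u : Fin n) : ¬ F.Desc u u := F.acyclic u

theorem Desc.trans {F : RootedForest (Fin n)} {u v w : Fin n} (h1 : F.Desc u v)
    (h2 : F.Desc v w) : F.Desc u w := Relation.TransGen.trans h2 h1

theorem desc_of_parent {F : RootedForest (Fin n)} {u v : Fin n} (h : F.parent v = some u) :
    F.Desc u v := Relation.TransGen.single h

theorem desc_iff {F : RootedForest (Fin n)} {u v p : Fin n} (h : F.parent v = some p) :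
    F.Desc u v ↔ (p = u ∨ F.Desc u p) := by
  constructor
  · intro hd
    obtain ⟨c, hc, hcu⟩ := (Relation.TransGen.head'_iff).1 hd
    rw [h] at hc
    obtain rfl := Option.some.inj hc
    rcases Relation.reflTransGen_iff_eq_or_transGen.1 hcu with h | h
    · exact Or.inl h.symm
    · exact Or.inr h
  · rintro (rfl | hd)
    · exact desc_of_parent h
    · exact hd.trans (desc_of_parent h)

theorem not_desc_root {F : RootedForest (Fin n)} {u v : Fin n} (h : F.parent v = none) :
    ¬ F.Desc u v := by
  intro hd
  obtain ⟨c, hc, hcu⟩ := (Relation.TransGen.head'_iff).1 hd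
  rw [h] at hc
  cases hc

theorem mem_hook_iff (F : RootedForest (Fin n)) (u v : Fin n) :
    v ∈ F.hook u ↔ Relation.ReflTransGen (fun a b : Fin n => F.parent a = some b) v u := by
  rw [Relation.reflTransGen_iff_eq_or_transGen]
  simp [hook, Desc, eq_comm]

theorem chain (F : RootedForest (Fin n)) {u v x : Fin n} (hu : x ∈ F.hook u)
    (hv : x ∈ F.hook v) : u = v ∨ F.Desc u v ∨ F.Desc v u := by
  rw [mem_hook_iff] at hu hv
  have := Relation.ReflTransGen.total_of_right_unique
    (r := fun a b : Fin n => F.parent a = some b)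
    (by intro a b c hb hc; exact Option.some.inj (hb.symm.trans hc)) hu hv
  rw [← mem_hook_iff, ← mem_hook_iff] at this
  simp only [hook, Set.mem_ofPred_eq] at this
  rcases this with (h | h) | (h | h)
  · exact Or.inl h
  · exact Or.inr (Or.inr h)
  · exact Or.inl h.symm
  · exact Or.inr (Or.inl h)

/-- Finset hook. -/
noncomputable def hk (F : RootedForest (Fin n)) (u : Fin n) : Finset (Fin n) :=
  Finset.univ.filter (fun v => v = u ∨ F.Desc u v)

theorem h_eq (F : RootedForest (Fin n)) (u : Fin n) : F.h u = (F.hk u).card := by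
  rw [h, ← Set.ncard_coe_finset]
  congr 1
  ext x
  simp [hook, hk]

theorem hook_rec (F : RootedForest (Fin n)) (u : Fin n) :
    F.h u = 1 + ∑ c ∈ Finset.univ.filter (fun c => F.parent c = some u), F.h c := by
  have key : F.hk u = insert u
      ((Finset.univ.filter (fun c => F.parent c = some u)).biUnion F.hk) := by
    ext x
    simp only [hk, Finset.mem_filter, Finset.mem_univ, true_and, Finset.mem_insert,
      Finset.mem_biUnion]
    refine or_congr_right ?_
    constructor
    · intro hd
      obtain ⟨c, hc, hcu⟩ := (Relation.TransGen.tail'_iff).1 hd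
      refine ⟨c, hcu, ?_⟩
      rw [← mem_hook_iff] at hc
      exact hc
    · rintro ⟨c, hc, rfl | hd⟩
      · exact desc_of_parent hc
      · exact (desc_of_parent hc).trans hd
  rw [h_eq, key, Finset.card_insert_of_notMem, Finset.card_biUnion, add_comm]
  · simp only [h_eq]
  · intro c hc d hd hne
    replace hc : F.parent c = some u := by simpa using hc
    replace hd : F.parent d = some u := by simpa using hd
    change Disjoint (F.hk c) (F.hk d)
    rw [Finset.disjoint_left]
    intro x hx hx'
    simp only [hk, Finset.mem_filter, Finset.mem_univ, true_and] at hx hx'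
    rcases F.chain (u := c) (v := d) (x := x) hx hx' with h | h | h
    · exact hne h
    · rcases (desc_iff hd).1 h with h | h
      · exact F.desc_irrefl u (by subst h; exact desc_of_parent hc)
      · exact F.desc_irrefl u ((desc_of_parent hc).trans h)
    · rcases (desc_iff hc).1 h with h | h
      · exact F.desc_irrefl u (by subst h; exact desc_of_parent hd)
      · exact F.desc_irrefl u ((desc_of_parent hd).trans h)
  · simp only [hk, Finset.mem_filter, Finset.mem_univ, true_and, Finset.mem_biUnion, not_exists,
      not_and]
    rintro c hc (rfl | hd)
    · exact F.desc_irrefl _ (desc_of_parent hc)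
    · exact F.desc_irrefl _ (hd.trans (desc_of_parent hc))

/-- Value of `g` at the parent, `0` for roots. -/
def gp (F : RootedForest (Fin n)) (g : Fin n → ℤ) (v : Fin n) : ℤ :=
  match F.parent v with
  | none => 0
  | some p => g p

theorem sum_gp (F : RootedForest (Fin n)) (g : Fin n → ℤ) :
    ∑ v, F.gp g v * (F.h v : ℤ) = ∑ u, g u * ((F.h u : ℤ) - 1) := by
  have h1 : ∀ v, F.gp g v * (F.h v : ℤ) =
      ∑ u, if F.parent v = some u then g u * (F.h v : ℤ) else 0 := by
    intro v
    unfold gp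
    cases hp : F.parent v with
    | none => simp
    | some p => simp
  simp_rw [h1]
  rw [Finset.sum_comm]
  refine Finset.sum_congr rfl fun u _ => ?_
  rw [F.hook_rec u, ← Finset.sum_filter, ← Finset.mul_sum]
  push_cast
  ring

/-- rank of the label of `u` inside its hook -/
noncomputable def rk (F : RootedForest (Fin n)) (σ : Equiv.Perm (Fin n)) (u : Fin n) : ℕ :=
  (Finset.univ.filter (fun x => F.Desc u x ∧ σ x < σ u)).card

/-- descent weights of unprocessed edges -/
noncomputable def W (F : RootedForest (Fin n)) (U : Finset (Fin n)) (σ : Equiv.Perm (Fin n))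
    (v : Fin n) : ℕ :=
  if v ∉ U ∧ ∃ p, F.parent v = some p ∧ p ∉ U ∧ σ v < σ p then F.h v else 0

/-- hybrid statistic -/
noncomputable def stat (F : RootedForest (Fin n)) (U : Finset (Fin n))
    (σ : Equiv.Perm (Fin n)) : ℕ :=
  ∑ u ∈ U, F.rk σ u + ∑ v, F.W U σ v

theorem exists_rot (S : Finset (Fin n)) (m : Fin n) :
    ∃ t : Equiv.Perm (Fin n), t m = m ∧ (∀ x, x ∉ S → t x = x) ∧ (∀ x, x ∈ S → t x ∈ S) ∧
      ∀ a ∈ S, ∀ b ∈ S, a ≠ m → b ≠ m →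
        (t a < t b ↔ (m < a ∧ b < m) ∨ ((a < m ↔ b < m) ∧ a < b)) := by
  let k : Fin n → ℕ := fun x => if x < m then x.val + n else x.val
  have hk : Function.Injective k := by
    intro a b hab
    simp only [k] at hab
    apply Fin.ext
    split_ifs at hab <;> omega
  let T := S.erase m
  have hc : (T.image k).card = T.card := Finset.card_image_of_injective _ hk
  let e : Equiv.Perm {x // x ∈ T} :=
    (Equiv.ofBijective (fun x : {x // x ∈ T} =>
        (⟨k x, Finset.mem_image_of_mem k x.2⟩ : {y // y ∈ T.image k}))
      ⟨by intro a b hab; exact Subtype.ext (hk (by simpa using hab)), by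
        rintro ⟨y, hy⟩
        obtain ⟨x, hx, rfl⟩ := Finset.mem_image.1 hy
        exact ⟨⟨x, hx⟩, rfl⟩⟩).trans
    (((T.image k).orderIsoOfFin hc).symm.trans (T.orderIsoOfFin rfl)).toEquiv
  have he : ∀ a b : {x // x ∈ T}, e a < e b ↔ k a < k b := by
    intro a b
    simp only [e, Equiv.trans_apply, RelIso.coe_fn_toEquiv, OrderIso.lt_iff_lt]
    rfl
  refine ⟨Equiv.Perm.ofSubtype e, ?_, ?_, ?_, ?_⟩
  · exact Equiv.Perm.ofSubtype_apply_of_not_mem e (by simp [T])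
  · intro x hx
    exact Equiv.Perm.ofSubtype_apply_of_not_mem e (by simp [T, hx])
  · intro x hx
    by_cases hm : x ∈ T
    · rw [Equiv.Perm.ofSubtype_apply_of_mem e hm]
      exact Finset.mem_of_mem_erase (e ⟨x, hm⟩).2
    · rw [Equiv.Perm.ofSubtype_apply_of_not_mem e hm]
      exact hx
  · intro a ha b hb ham hbm
    have ha' : a ∈ T := Finset.mem_erase.2 ⟨ham, ha⟩
    have hb' : b ∈ T := Finset.mem_erase.2 ⟨hbm, hb⟩
    rw [Equiv.Perm.ofSubtype_apply_of_mem e ha', Equiv.Perm.ofSubtype_apply_of_mem e hb']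
    have := he ⟨a, ha'⟩ ⟨b, hb'⟩
    rw [Subtype.coe_lt_coe, this]
    simp only [k]
    have h1 : a.val ≠ m.val := fun h => ham (Fin.ext h)
    have h2 : b.val ≠ m.val := fun h => hbm (Fin.ext h)
    simp only [Fin.lt_def]
    split_ifs <;> omega

/-- chosen rotation -/
noncomputable def rot (S : Finset (Fin n)) (m : Fin n) : Equiv.Perm (Fin n) :=
  (exists_rot S m).choose

theorem rot_self (S : Finset (Fin n)) (m : Fin n) : rot S m m = m :=
  (exists_rot S m).choose_spec.1
theorem rot_notMem (S : Finset (Fin n)) (m : Fin n) : ∀ x, x ∉ S → rot S m x = x :=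
  (exists_rot S m).choose_spec.2.1
theorem rot_mem (S : Finset (Fin n)) (m : Fin n) : ∀ x, x ∈ S → rot S m x ∈ S :=
  (exists_rot S m).choose_spec.2.2.1
theorem rot_lt (S : Finset (Fin n)) (m : Fin n) : ∀ a ∈ S, ∀ b ∈ S, a ≠ m → b ≠ m →
    (rot S m a < rot S m b ↔ (m < a ∧ b < m) ∨ ((a < m ↔ b < m) ∧ a < b)) :=
  (exists_rot S m).choose_spec.2.2.2

theorem rot_image (S : Finset (Fin n)) (m : Fin n) : S.image (rot S m) = S := by
  apply Finset.eq_of_subset_of_card_le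
  · intro x hx
    obtain ⟨y, hy, rfl⟩ := Finset.mem_image.1 hx
    exact rot_mem S m y hy
  · rw [Finset.card_image_of_injective _ (rot S m).injective]

theorem rot_symm_image (S : Finset (Fin n)) (m : Fin n) : S.image (rot S m).symm = S := by
  have h : (S.image (rot S m)).image (rot S m).symm = S := by
    rw [Finset.image_image]
    ext x
    simp
  rwa [rot_image] at h

/-- The step bijection. -/
noncomputable def stepEquiv (H : Finset (Fin n)) (r : Fin n) :
    Equiv.Perm (Fin n) ≃ Equiv.Perm (Fin n) where
  toFun σ := rot (H.image σ) (σ r) * σ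
  invFun σ := (rot (H.image σ) (σ r)).symm * σ
  left_inv σ := by
    have h1 : H.image (rot (H.image σ) (σ r) * σ : Equiv.Perm (Fin n)) = H.image σ := by
      rw [Equiv.Perm.coe_mul, ← Finset.image_image, rot_image]
    have h2 : (rot (H.image σ) (σ r) * σ : Equiv.Perm (Fin n)) r = σ r := by
      simp [rot_self]
    simp only [h1, h2]
    ext x
    simp
  right_inv σ := by
    have h1 : H.image ((rot (H.image σ) (σ r)).symm * σ : Equiv.Perm (Fin n)) = H.image σ := by
      rw [Equiv.Perm.coe_mul, ← Finset.image_image, rot_symm_image]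
    have h2 : ((rot (H.image σ) (σ r)).symm * σ : Equiv.Perm (Fin n)) r = σ r := by
      simp [Equiv.symm_apply_eq, rot_self]
    simp only [h1, h2]
    ext x
    simp

/-- closed under taking parents -/
def UpClosed (F : RootedForest (Fin n)) (U : Finset (Fin n)) : Prop :=
  ∀ u v, F.Desc u v → v ∈ U → u ∈ U

theorem step (F : RootedForest (Fin n)) (U : Finset (Fin n)) (hU : F.UpClosed U) (r : Fin n)
    (hr : r ∉ U) (hp : ∀ p, F.parent r = some p → p ∈ U) (σ : Equiv.Perm (Fin n)) :
    F.stat U σ = F.stat (insert r U) (stepEquiv (F.hk r) r σ) := by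
  set τ := stepEquiv (F.hk r) r σ with hτ
  have hτx : ∀ x, τ x = rot ((F.hk r).image σ) (σ r) (σ x) := fun x => rfl
  have hmem : ∀ x, σ x ∈ (F.hk r).image σ ↔ (x = r ∨ F.Desc r x) := by
    intro x
    simp [hk]
  have hτr : τ r = σ r := by rw [hτx, rot_self]
  have hτo : ∀ x, ¬ F.Desc r x → τ x = σ x := by
    intro x hx
    by_cases hxr : x = r
    · rw [hxr, hτr]
    · rw [hτx, rot_notMem]
      rw [hmem]
      tauto
  let π : Equiv.Perm (Fin n) := τ.trans σ.symm
  have hσπ : ∀ x, σ (π x) = τ x := by intro x; simp [π]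
  have hπd : ∀ x, F.Desc r x → F.Desc r (π x) := by
    intro x hx
    have h1 : σ (π x) ∈ (F.hk r).image σ := by
      rw [hσπ, hτx]
      exact rot_mem _ _ _ ((hmem x).2 (Or.inr hx))
    rcases (hmem _).1 h1 with h | h
    · exfalso
      have h2 : τ x = τ r := by rw [← hσπ, h, hτr]
      have h3 := τ.injective h2
      subst h3
      exact F.desc_irrefl _ hx
    · exact h
  have hrk : ∀ u ∈ insert r U, F.rk τ u = F.rk σ u := by
    intro u hu
    have hur : ¬ F.Desc r u := by
      intro hd
      rcases Finset.mem_insert.1 hu with rfl | hu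
      · exact F.desc_irrefl _ hd
      · exact hr (hU _ _ hd hu)
    have hch : ∀ x, F.Desc r x → (F.Desc u x ↔ (u = r ∨ F.Desc u r)) := by
      intro x hx
      constructor
      · intro hux
        rcases F.chain (u := u) (v := r) (x := x) (Or.inr hux) (Or.inr hx) with h | h | h
        · exact Or.inl h
        · exact Or.inr h
        · exact absurd h hur
      · rintro (rfl | h)
        · exact hx
        · exact h.trans hx
    have hud : ∀ x, F.Desc u (π x) ↔ F.Desc u x := by
      intro x
      by_cases hx : F.Desc r x
      · rw [hch x hx, hch _ (hπd x hx)]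
      · have : π x = x := σ.injective (by rw [hσπ, hτo x hx])
        rw [this]
    unfold rk
    refine Finset.card_bij (fun x _ => π x) ?_ ?_ ?_
    · intro x hx
      simp only [Finset.mem_filter, Finset.mem_univ, true_and] at hx ⊢
      rw [hud, hσπ, ← hτo u hur]
      exact hx
    · intro a _ b _ hab
      exact π.injective hab
    · intro y hy
      obtain ⟨x, rfl⟩ := π.surjective y
      refine ⟨x, ?_, rfl⟩
      simp only [Finset.mem_filter, Finset.mem_univ, true_and] at hy ⊢
      rw [hud, hσπ, ← hτo u hur] at hy
      exact hy
  have hW : ((∑ v, F.W U σ v : ℕ) : ℤ) = F.rk σ r + ((∑ v, F.W (insert r U) τ v : ℕ) : ℤ) := by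
    let g : Fin n → ℤ := fun u => if F.Desc r u ∧ σ u < σ r then 1 else 0
    have hg : ∀ v, (F.W U σ v : ℤ) - F.W (insert r U) τ v = g v * F.h v - F.gp g v * F.h v := by
      intro v
      by_cases hv : F.Desc r v
      · have hvr : v ≠ r := by rintro rfl; exact F.desc_irrefl _ hv
        have hvU : v ∉ U := fun h => hr (hU _ _ hv h)
        cases hpv : F.parent v with
        | none => exact absurd hv (not_desc_root hpv)
        | some p =>
          have hpr := (desc_iff hpv).1 hv
          have hσvr : σ v ≠ σ r := fun h => hvr (σ.injective h)
          have hgp : F.gp g v = g p := by simp [gp, hpv]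
          rw [hgp]
          by_cases hpr' : p = r
          · subst hpr'
            simp [W, g, hpv, hvr, hvU, hr, hv]
          · have hpd : F.Desc r p := by tauto
            have hpU : p ∉ U := fun h => hr (hU _ _ hpd h)
            have hσpr : σ p ≠ σ r := fun h => hpr' (σ.injective h)
            have hlt := rot_lt ((F.hk r).image σ) (σ r) (σ v) ((hmem v).2 (Or.inr hv))
              (σ p) ((hmem p).2 (Or.inr hpd)) hσvr hσpr
            rw [← hτx, ← hτx] at hlt
            simp only [W, g, hpv, hvr, hvU, hpU, hv, hpd, hpr', hlt, Finset.mem_insert,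
              Option.some.injEq, or_self, not_false_eq_true, true_and, exists_eq_left']
            rcases lt_or_gt_of_ne hσvr with h1 | h1 <;> rcases lt_or_gt_of_ne hσpr with h2 | h2
            · simp [h1, h2, h1.not_gt]
            · simp [h1, h2, h2.not_gt, h1.not_gt, h1.trans h2]
            · simp [h1, h2, h1.not_gt, (h2.trans h1).not_gt]
            · simp [h1.not_gt, h2.not_gt]
      · have hgv : g v = 0 := by simp [g, hv]
        have hgpv : F.gp g v = 0 := by
          cases hpv : F.parent v with
          | none => simp [gp, hpv]
          | some p =>
            have : ¬ F.Desc r p := fun h => hv ((desc_iff hpv).2 (Or.inr h))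
            simp [gp, hpv, g, this]
        rw [hgv, hgpv]
        have : F.W U σ v = F.W (insert r U) τ v := by
          unfold W
          cases hpv : F.parent v with
          | none => simp
          | some p =>
            by_cases hvr : v = r
            · subst hvr
              have := hp p hpv
              simp [this]
            · have hpr : p ≠ r := fun h => hv ((desc_iff hpv).2 (Or.inl h))
              have hpd : ¬ F.Desc r p := fun h => hv ((desc_iff hpv).2 (Or.inr h))
              simp [hvr, hpr, hτo v hv, hτo p hpd]
        rw [this]; ring
    have hs : ∑ v, ((F.W U σ v : ℤ) - F.W (insert r U) τ v) = F.rk σ r := by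
      simp_rw [hg]
      rw [Finset.sum_sub_distrib, sum_gp, ← Finset.sum_sub_distrib]
      have : ∀ v, g v * (F.h v : ℤ) - g v * ((F.h v : ℤ) - 1) = g v := by intro v; ring
      simp_rw [this]
      simp [g, rk]
    rw [Finset.sum_sub_distrib] at hs
    push_cast
    linarith
  unfold stat
  rw [Finset.sum_congr rfl hrk, Finset.sum_insert hr]
  have : ∑ v, F.W U σ v = F.rk σ r + ∑ v, F.W (insert r U) τ v := by exact_mod_cast hW
  rw [this]; ring

theorem exists_next (F : RootedForest (Fin n)) (U : Finset (Fin n)) (hne : U ≠ Finset.univ) :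
    ∃ r, r ∉ U ∧ ∀ u, F.Desc u r → u ∈ U := by
  have hwf : WellFounded F.Desc := by
    haveI : IsTrans (Fin n) F.Desc := ⟨fun _ _ _ h1 h2 => h1.trans h2⟩
    haveI : Std.Irrefl F.Desc := ⟨F.desc_irrefl⟩
    exact Finite.wellFounded_of_trans_of_irrefl _
  obtain ⟨a, ha⟩ : ∃ a, a ∉ U := by
    by_contra hcon
    push Not at hcon
    exact hne (Finset.eq_univ_iff_forall.2 hcon)
  obtain ⟨r, hr, hmin⟩ := hwf.has_min {x | x ∉ U} ⟨a, ha⟩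
  refine ⟨r, hr, fun u hu => ?_⟩
  by_contra hcon
  exact hmin u hcon hu

theorem exists_equiv (F : RootedForest (Fin n)) (k : ℕ) : ∀ (U : Finset (Fin n)),
    F.UpClosed U → Uᶜ.card = k →
    ∃ e : Equiv.Perm (Fin n) ≃ Equiv.Perm (Fin n),
      ∀ σ, F.stat U σ = F.stat Finset.univ (e σ) := by
  induction k with
  | zero =>
    intro U _ hc
    have : U = Finset.univ := by simpa using hc
    subst this
    exact ⟨Equiv.refl _, fun _ => rfl⟩
  | succ k ih =>
    intro U hU hc
    have hne : U ≠ Finset.univ := by rintro rfl; simp at hc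
    obtain ⟨r, hr, hmin⟩ := F.exists_next U hne
    have hU' : F.UpClosed (insert r U) := by
      intro u v huv hv
      rcases Finset.mem_insert.1 hv with rfl | hv
      · exact Finset.mem_insert_of_mem (hmin u huv)
      · exact Finset.mem_insert_of_mem (hU u v huv hv)
    obtain ⟨e, he⟩ := ih (insert r U) hU' (by
      rw [Finset.compl_insert, Finset.card_erase_of_mem (by simpa using hr), hc]; rfl)
    refine ⟨(stepEquiv (F.hk r) r).trans e, fun σ => ?_⟩
    rw [F.step U hU r hr (fun p hp => hmin p (desc_of_parent hp)) σ, he]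
    rfl

theorem maj_eq (F : RootedForest (Fin n)) :
    F.maj = ∑ v, if ∃ p, F.parent v = some p ∧ v < p then F.h v else 0 := by
  unfold maj hL
  simp_rw [Finset.sum_filter]
  rw [Finset.sum_comm]
  refine Finset.sum_congr rfl fun v _ => ?_
  cases hp : F.parent v with
  | none => simp
  | some p => simp [ite_and]

theorem comaj_eq (F : RootedForest (Fin n)) :
    F.comaj = ∑ v, if ∃ p, F.parent v = some p ∧ p < v then F.h v else 0 := by
  unfold comaj hR
  simp_rw [Finset.sum_filter]
  rw [Finset.sum_comm]
  refine Finset.sum_congr rfl fun v _ => ?_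
  cases hp : F.parent v with
  | none => simp
  | some p => simp [ite_and]

theorem maj_relabel (F : RootedForest (Fin n)) (σ : Equiv.Perm (Fin n)) :
    (F.relabel σ).maj = F.stat ∅ σ := by
  rw [maj_eq, ← Equiv.sum_comp σ]
  simp only [stat, Finset.sum_empty, zero_add]
  refine Finset.sum_congr rfl fun v _ => ?_
  simp only [W, relabel_parent, relabel_h]
  cases hp : F.parent v with
  | none => simp
  | some p => simp

theorem inv_eq (F : RootedForest (Fin n)) : F.inv = ∑ u, F.rk 1 u := by
  unfold inv rk
  rw [← Finset.card_sigma, ← Set.ncard_coe_finset]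
  refine Set.ncard_congr (fun p _ => ⟨p.1, p.2⟩) ?_ ?_ ?_
  · rintro ⟨a, b⟩ h
    simp only [Finset.mem_coe, Finset.mem_sigma, Finset.mem_filter, Finset.mem_univ, true_and]
    exact h
  · rintro ⟨a, b⟩ ⟨c, d⟩ _ _ h
    simpa using h
  · rintro ⟨a, b⟩ h
    simp only [Finset.mem_coe, Finset.mem_sigma, Finset.mem_filter, Finset.mem_univ,
      true_and] at h
    exact ⟨(a, b), h, rfl⟩

theorem rk_relabel (F : RootedForest (Fin n)) (σ : Equiv.Perm (Fin n)) (u : Fin n) :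
    (F.relabel σ).rk 1 (σ u) = F.rk σ u := by
  unfold rk
  symm
  refine Finset.card_bij (fun x _ => σ x) ?_ ?_ ?_
  · intro x hx
    simp only [Finset.mem_filter, Finset.mem_univ, true_and, relabel_desc] at hx ⊢
    exact hx
  · intro a _ b _ h
    exact σ.injective h
  · intro y hy
    obtain ⟨x, rfl⟩ := σ.surjective y
    simp only [Finset.mem_filter, Finset.mem_univ, true_and, relabel_desc] at hy
    exact ⟨x, by simp only [Finset.mem_filter, Finset.mem_univ, true_and]; exact hy, rfl⟩

theorem inv_relabel (F : RootedForest (Fin n)) (σ : Equiv.Perm (Fin n)) :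
    (F.relabel σ).inv = F.stat Finset.univ σ := by
  rw [inv_eq, ← Equiv.sum_comp σ]
  simp only [rk_relabel, stat]
  simp [W]

/-- total number of descendant pairs -/
noncomputable def tot (F : RootedForest (Fin n)) : ℕ := {p : Fin n × Fin n | F.Desc p.1 p.2}.ncard

theorem inv_add_coinv (F : RootedForest (Fin n)) : F.inv + F.coinv = F.tot := by
  unfold inv coinv tot
  rw [← Set.ncard_union_eq]
  · congr 1
    ext ⟨a, b⟩
    simp only [Set.mem_union, Set.mem_ofPred_eq]
    constructor
    · rintro (h | h) <;> exact h.1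
    · intro h
      have : a ≠ b := by rintro rfl; exact F.desc_irrefl _ h
      rcases lt_or_gt_of_ne this with h' | h'
      · exact Or.inr ⟨h, h'⟩
      · exact Or.inl ⟨h, h'⟩
  · rw [Set.disjoint_left]
    rintro ⟨a, b⟩ h1 h2
    exact lt_asymm h1.2 h2.2

theorem tot_eq (F : RootedForest (Fin n)) : (F.tot : ℤ) = ∑ u, ((F.h u : ℤ) - 1) := by
  have h1 : F.tot = ∑ u, (Finset.univ.filter (fun v => F.Desc u v)).card := by
    unfold tot
    rw [← Finset.card_sigma, ← Set.ncard_coe_finset]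
    refine Set.ncard_congr (fun p _ => ⟨p.1, p.2⟩) ?_ ?_ ?_
    · rintro ⟨a, b⟩ h
      simpa using h
    · rintro ⟨a, b⟩ ⟨c, d⟩ _ _ h
      simpa using h
    · rintro ⟨a, b⟩ h
      exact ⟨(a, b), by simpa using h, rfl⟩
  rw [h1]
  push_cast
  refine Finset.sum_congr rfl fun u _ => ?_
  have : F.hk u = insert u (Finset.univ.filter (fun v => F.Desc u v)) := by
    ext x
    simp [hk]
  rw [h_eq, this, Finset.card_insert_of_notMem (by simpa using F.desc_irrefl u)]
  push_cast
  ring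

theorem maj_add_comaj (F : RootedForest (Fin n)) : F.maj + F.comaj = F.tot := by
  have h := F.sum_gp (fun _ => 1)
  simp only [one_mul] at h
  rw [← tot_eq] at h
  have : ((F.maj + F.comaj : ℕ) : ℤ) = F.tot := by
    rw [← h, maj_eq, comaj_eq, ← Finset.sum_add_distrib]
    push_cast
    refine Finset.sum_congr rfl fun v _ => ?_
    cases hp : F.parent v with
    | none => simp [gp, hp]
    | some p =>
      have hne : v ≠ p := by rintro rfl; exact F.desc_irrefl _ (desc_of_parent hp)
      rcases lt_or_gt_of_ne hne with h' | h' <;> simp [gp, hp, h', h'.not_gt]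
  exact_mod_cast this

theorem tot_relabel (F : RootedForest (Fin n)) (σ : Equiv.Perm (Fin n)) :
    (F.relabel σ).tot = F.tot := by
  have h1 := (F.relabel σ).tot_eq
  rw [← Equiv.sum_comp σ] at h1
  simp only [relabel_h] at h1
  rw [← tot_eq] at h1
  exact_mod_cast h1

instance : Finite (RootedForest (Fin n)) :=
  Finite.of_injective (fun F : RootedForest (Fin n) => F.parent)
    (fun _ _ h => ext' (fun v => congrFun h v))

noncomputable instance : Fintype (RootedForest (Fin n)) := Fintype.ofFinite _

/-- isomorphism classes -/
def isoSetoid (n : ℕ) : Setoid (RootedForest (Fin n)) where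
  r F G := ∃ σ, F.relabel σ = G
  iseqv := by
    refine ⟨fun F => ⟨1, relabel_one F⟩, ?_, ?_⟩
    · rintro F G ⟨σ, rfl⟩
      exact ⟨σ⁻¹, by rw [← relabel_mul, inv_mul_cancel, relabel_one]⟩
    · rintro F G H ⟨σ, rfl⟩ ⟨τ, rfl⟩
      exact ⟨τ * σ, relabel_mul _ _ _⟩

theorem fiber_card (F G : RootedForest (Fin n)) (h : ∃ σ, F.relabel σ = G) :
    (Finset.univ.filter (fun σ => F.relabel σ = G)).card =
      (Finset.univ.filter (fun σ => F.relabel σ = F)).card := by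
  obtain ⟨σ, rfl⟩ := h
  symm
  refine Finset.card_bij (fun τ _ => σ * τ) ?_ ?_ ?_
  · intro τ hτ
    simp only [Finset.mem_filter, Finset.mem_univ, true_and] at hτ ⊢
    rw [relabel_mul, hτ]
  · intro a _ b _ hab
    exact mul_left_cancel hab
  · intro y hy
    simp only [Finset.mem_filter, Finset.mem_univ, true_and] at hy
    refine ⟨σ⁻¹ * y, ?_, by simp⟩
    simp only [Finset.mem_filter, Finset.mem_univ, true_and]
    rw [relabel_mul, hy, ← relabel_mul, inv_mul_cancel, relabel_one]

theorem orbit_count (F : RootedForest (Fin n)) (f : RootedForest (Fin n) → ℕ) (k : ℕ) :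
    (Finset.univ.filter (fun σ => f (F.relabel σ) = k)).card =
      (Finset.univ.filter (fun G => (∃ σ, F.relabel σ = G) ∧ f G = k)).card *
      (Finset.univ.filter (fun σ => F.relabel σ = F)).card := by
  rw [Finset.card_eq_sum_card_fiberwise (f := fun σ => F.relabel σ)
    (t := Finset.univ.filter (fun G => (∃ σ, F.relabel σ = G) ∧ f G = k))]
  · rw [← smul_eq_mul, ← Finset.sum_const]
    refine Finset.sum_congr rfl fun G hG => ?_
    simp only [Finset.mem_filter, Finset.mem_univ, true_and] at hG
    rw [← fiber_card F G hG.1]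
    congr 1
    ext σ
    simp only [Finset.mem_filter, Finset.mem_univ, true_and]
    constructor
    · exact fun h => h.2
    · rintro rfl
      exact ⟨hG.2, rfl⟩
  · intro σ hσ
    simpa using hσ

theorem class_count (F : RootedForest (Fin n)) (k : ℕ) :
    (Finset.univ.filter (fun G : RootedForest (Fin n) =>
      (∃ σ, F.relabel σ = G) ∧ G.maj = k)).card =
    (Finset.univ.filter (fun G : RootedForest (Fin n) =>
      (∃ σ, F.relabel σ = G) ∧ G.inv = k)).card := by
  have h1 := F.orbit_count (fun G => G.maj) k
  have h2 := F.orbit_count (fun G => G.inv) k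
  have hpos : 0 < (Finset.univ.filter (fun σ => F.relabel σ = F)).card :=
    Finset.card_pos.2 ⟨1, by simp [relabel_one]⟩
  apply Nat.eq_of_mul_eq_mul_right hpos
  rw [← h1, ← h2]
  obtain ⟨e, he⟩ := F.exists_equiv _ ∅ (by intro u v _ h; simp at h) rfl
  refine Finset.card_bij (fun σ _ => e σ) ?_ ?_ ?_
  · intro σ hσ
    simpa [maj_relabel, inv_relabel, he] using hσ
  · intro a _ b _ hab
    exact e.injective hab
  · intro y hy
    obtain ⟨x, rfl⟩ := e.surjective y
    exact ⟨x, by simpa [maj_relabel, inv_relabel, he] using hy, rfl⟩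

theorem exists_equiv_of_fibers {α β : Type} [Fintype α] (f g : α → β)
    (h : ∀ a, Fintype.card {x // f x = a} = Fintype.card {x // g x = a}) :
    ∃ e : α ≃ α, ∀ a, g (e a) = f a := by
  let e : α ≃ α := (Equiv.sigmaFiberEquiv f).symm.trans
    ((Equiv.sigmaCongrRight fun b => Fintype.equivOfCardEq (h b)).trans (Equiv.sigmaFiberEquiv g))
  refine ⟨e, fun a => ?_⟩
  exact ((Fintype.equivOfCardEq (h (f a))) ⟨a, rfl⟩).2

end RootedForest

/-- For every `n ≥ 1`, the bi-statistics `(maj, comaj)` and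
`(inv, coinv)` have the same joint distribution over `R_n`: there is a bijection
`ξ : R_n → R_n` such that `ξ F` is isomorphic to `F` as a rooted forest (via a
root- and edge-preserving relabelling `ζ`), `maj F = inv (ξ F)`, and
`comaj F = coinv (ξ F)` for all `F`. -/
theorem stmt18 (n : ℕ) (hn : 1 ≤ n) :
    ∃ ξ : RootedForest (Fin n) ≃ RootedForest (Fin n),
      ∀ F : RootedForest (Fin n),
        (∃ ζ : Equiv.Perm (Fin n),
          ∀ v : Fin n, (ξ F).parent (ζ v) = Option.map ζ (F.parent v)) ∧
        F.maj = (ξ F).inv ∧ F.comaj = (ξ F).coinv := by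
  classical
  let q : RootedForest (Fin n) → Quotient (RootedForest.isoSetoid n) := Quotient.mk _
  have hq : ∀ F G, q F = q G ↔ ∃ σ, F.relabel σ = G := fun F G => Quotient.eq
  obtain ⟨e, he⟩ := RootedForest.exists_equiv_of_fibers
    (fun F : RootedForest (Fin n) => (q F, F.maj)) (fun F => (q F, F.inv)) (by
      rintro ⟨c, k⟩
      obtain ⟨F, rfl⟩ := Quotient.exists_rep c
      have h := F.class_count k
      rw [Fintype.card_subtype, Fintype.card_subtype]
      have h1 : ∀ (f : RootedForest (Fin n) → ℕ) (G : RootedForest (Fin n)),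
          (q G, f G) = (q F, k) ↔ ((∃ σ, F.relabel σ = G) ∧ f G = k) := by
        intro f G
        rw [Prod.mk.injEq, ← hq F G, eq_comm (a := q F)]
      calc _ = _ := ?_
        _ = _ := h
        _ = _ := ?_
      · congr 1
        ext G
        simp only [Finset.mem_filter, Finset.mem_univ, true_and]
        exact h1 _ G
      · congr 1
        ext G
        simp only [Finset.mem_filter, Finset.mem_univ, true_and]
        exact (h1 _ G).symm)
  refine ⟨e, fun F => ?_⟩
  have h := he F
  simp only [Prod.mk.injEq] at h
  obtain ⟨σ, hσ⟩ := (hq _ _).1 h.1.symm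
  refine ⟨⟨σ, fun v => ?_⟩, h.2.symm, ?_⟩
  · rw [← hσ, RootedForest.relabel_parent]
  · have h1 := F.maj_add_comaj
    have h2 := (e F).inv_add_coinv
    have h3 := F.tot_relabel σ
    rw [hσ] at h3
    omega
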